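/- There is no function Ψ : (ℕ → ℕ → Bool) → (ℕ → ℕ) such that (i) for every relation code X coding a linear order on ℕ, the sequence Ψ X is ascending for X or descending for X, and (ii) Ψ is continuous at the point X₀ coding the usual order on ℕ. (This is the set-theoretic content of the paper's Theorem that the uniform ascending/descending sequence principle UADS is equivalent to arithmetical comprehension: any uniform ADS-functional is discontinuous.) -/

import Mathlib

/-- `X` codes a linear order on `ℕ`. -/
def LinOrderCode (X : ℕ → ℕ → Bool) : Prop :=
  (∀ x, X x x = true) ∧
  (∀ x y z, X x y = true → X y z = true → X x z = true) ∧
  (∀ x y, X x y = true → X y x = true → x = y) ∧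
  (∀ x y, X x y = true ∨ X y x = true)

/-- `x` is an ascending sequence for the order coded by `X`. -/
def Ascending (X : ℕ → ℕ → Bool) (x : ℕ → ℕ) : Prop :=
  ∀ n, X (x n) (x (n + 1)) = true ∧ x n ≠ x (n + 1)

/-- `x` is a descending sequence for the order coded by `X`. -/
def Descending (X : ℕ → ℕ → Bool) (x : ℕ → ℕ) : Prop :=
  ∀ n, X (x (n + 1)) (x n) = true ∧ x n ≠ x (n + 1)

/-- The usual order below `N`, followed by the numbers from `N` on in reverse order;
its order type is `N + ω*`. -/
def tailReversed (N a b : ℕ) : Bool :=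
  decide (if a < N then a ≤ b else N ≤ b ∧ b ≤ a)

theorem tailReversed_eq_true {N a b : ℕ} :
    tailReversed N a b = true ↔ (a < N ∧ a ≤ b) ∨ (N ≤ b ∧ b ≤ a) := by
  unfold tailReversed
  split_ifs <;> simp <;> omega

theorem linOrderCode_tailReversed (N : ℕ) : LinOrderCode (tailReversed N) := by
  simp only [LinOrderCode, tailReversed_eq_true]
  refine ⟨?_, ?_, ?_, ?_⟩ <;> intros <;> omega

theorem linOrderCode_le : LinOrderCode (fun a b => decide (a ≤ b)) := by
  simp only [LinOrderCode, decide_eq_true_eq]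
  refine ⟨?_, ?_, ?_, ?_⟩ <;> intros <;> omega

theorem not_descending_le (x : ℕ → ℕ) : ¬ Descending (fun a b => decide (a ≤ b)) x := by
  intro h
  simp only [Descending, decide_eq_true_eq] at h
  have key : ∀ n, x n + n ≤ x 0 := by
    intro n
    induction n with
    | zero => simp
    | succ n ih => have := h n; omega
  have := key (x 0 + 1)
  omega

theorem not_ascending_tailReversed (N : ℕ) (x : ℕ → ℕ) : ¬ Ascending (tailReversed N) x := by
  intro h
  simp only [Ascending, tailReversed_eq_true] at h
  by_cases hx : ∃ k, N ≤ x k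
  · obtain ⟨k, hk⟩ := hx
    have key : ∀ n, N ≤ x (k + n) ∧ x (k + n) + n ≤ x k := by
      intro n
      induction n with
      | zero => simpa using hk
      | succ n ih => have := h (k + n); rw [← add_assoc]; omega
    have := key (x k + 1)
    omega
  · push Not at hx
    have key : ∀ n, n ≤ x n := by
      intro n
      induction n with
      | zero => simp
      | succ n ih => have := h n; have := hx (n + 1); omega
    exact (hx N).not_ge (key N)

open Filter Topology in
theorem tendsto_tailReversed :
    Tendsto tailReversed atTop (𝓝 fun a b => decide (a ≤ b)) := by
  refine tendsto_pi_nhds.2 fun a => tendsto_pi_nhds.2 fun b => ?_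
  refine tendsto_const_nhds.congr' ?_
  filter_upwards [eventually_gt_atTop a] with N hN
  simp [tailReversed, hN]

/-- There is no uniform ADS-functional that is continuous at the usual order on `ℕ`. -/
theorem no_continuous_uniform_ADS :
    ¬ ∃ Ψ : (ℕ → ℕ → Bool) → (ℕ → ℕ),
      (∀ X : ℕ → ℕ → Bool, LinOrderCode X → Ascending X (Ψ X) ∨ Descending X (Ψ X)) ∧
      ContinuousAt Ψ (fun a b => decide (a ≤ b)) := by
  rintro ⟨Ψ, hΨ, hc⟩
  have hasc := (hΨ _ linOrderCode_le).resolve_right (not_descending_le _) 0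
  simp only [decide_eq_true_eq] at hasc
  have hlim := tendsto_pi_nhds.1 (hc.tendsto.comp tendsto_tailReversed)
  have h0 := hlim 0
  have h1 := hlim 1
  rw [nhds_discrete, Filter.tendsto_pure] at h0 h1
  obtain ⟨N, h0, h1, hN⟩ := (h0.and (h1.and (Filter.eventually_gt_atTop
    (Ψ (fun a b => decide (a ≤ b)) 1)))).exists
  have hdesc := (hΨ _ (linOrderCode_tailReversed N)).resolve_left
    (not_ascending_tailReversed N _) 0
  simp only [Function.comp_apply] at h0 h1
  simp only [zero_add, h0, h1, tailReversed_eq_true] at hdesc hasc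
  omega
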